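/- The bracket of the q-Poisson algebra su_q^P(3) satisfies the Jacobi identity: for all smooth functions f, g, k : ℝ⁹ → ℝ, {f,{g,k}} + {g,{k,f}} + {k,{f,g}} = 0, so that su_q^P(3) is a Poisson algebra. -/

import Mathlib

/-- Partial derivative of a function on ℝ⁹ in the `i`-th coordinate direction.
Coordinates: (x 0,…,x 8) = (h₁,h₂,h₃,a₁₂,a₂₁,a₂₃,a₃₂,a₁₃,a₃₁). -/
noncomputable def pd (i : Fin 9) (f : (Fin 9 → ℝ) → ℝ) (x : Fin 9 → ℝ) : ℝ :=
  fderiv ℝ f x (Pi.single i 1)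

/-- The structure functions π(u,v) of su_q^P(3) for u < v (zero otherwise);
indices: 0=h₁, 1=h₂, 2=h₃, 3=a₁₂, 4=a₂₁, 5=a₂₃, 6=a₃₂, 7=a₁₃, 8=a₃₁. -/
noncomputable def piU (z : ℝ) (u v : ℕ) (x : Fin 9 → ℝ) : ℝ :=
  match u, v with
  | 0, 3 => x 3
  | 0, 4 => -x 4
  | 0, 7 => x 7
  | 0, 8 => -x 8
  | 1, 3 => -x 3
  | 1, 4 => x 4
  | 1, 5 => x 5
  | 1, 6 => -x 6
  | 2, 5 => -x 5
  | 2, 6 => x 6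
  | 2, 7 => -x 7
  | 2, 8 => x 8
  | 3, 4 => Real.sinh (z * (x 0 - x 1)) / z
  | 3, 5 => x 7
  | 3, 7 => z ^ 2 * x 3 ^ 2 * x 5
  | 3, 8 => -(Real.cosh (z * (x 0 - x 1)) * x 6)
  | 4, 6 => -x 8
  | 4, 7 => Real.cosh (z * (x 0 - x 1)) * x 5
  | 4, 8 => -(z ^ 2 * x 4 ^ 2 * x 6)
  | 5, 6 => Real.sinh (z * (x 1 - x 2)) / z
  | 5, 7 => -(z ^ 2 * x 5 ^ 2 * x 3)
  | 5, 8 => Real.cosh (z * (x 1 - x 2)) * x 4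
  | 6, 7 => -(Real.cosh (z * (x 1 - x 2)) * x 3)
  | 6, 8 => z ^ 2 * x 6 ^ 2 * x 4
  | 7, 8 => Real.sinh (z * (x 0 - x 2)) / z
      + z * Real.sinh (z * (x 0 - x 1)) * x 5 * x 6
      + z * Real.sinh (z * (x 1 - x 2)) * x 3 * x 4
  | _, _ => 0

/-- The bracket of the q-Poisson algebra su_q^P(3):
{f,g} = Σ_{u<v} π(u,v)(∂_u f ∂_v g − ∂_v f ∂_u g). -/
noncomputable def suq3Bracket (z : ℝ) (f g : (Fin 9 → ℝ) → ℝ) (x : Fin 9 → ℝ) : ℝ :=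
  ∑ u : Fin 9, ∑ v : Fin 9,
    if u < v then piU z u.val v.val x * (pd u f x * pd v g x - pd v f x * pd u g x)
    else 0

/-- The structure matrix of su_q^P(3), extended antisymmetrically to all pairs of indices. -/
noncomputable def piMat (z : ℝ) (u v : Fin 9) (x : Fin 9 → ℝ) : ℝ :=
  piU z u v x - piU z v u x

/-- The derivative of `piU z u v` at `x` in the direction `w`. -/
noncomputable def piUDeriv (z : ℝ) (u v : ℕ) (x w : Fin 9 → ℝ) : ℝ :=
  match u, v with
  | 0, 3 => w 3
  | 0, 4 => -w 4
  | 0, 7 => w 7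
  | 0, 8 => -w 8
  | 1, 3 => -w 3
  | 1, 4 => w 4
  | 1, 5 => w 5
  | 1, 6 => -w 6
  | 2, 5 => -w 5
  | 2, 6 => w 6
  | 2, 7 => -w 7
  | 2, 8 => w 8
  | 3, 4 => Real.cosh (z * (x 0 - x 1)) * (w 0 - w 1)
  | 3, 5 => w 7
  | 3, 7 => z ^ 2 * (2 * x 3 * w 3 * x 5 + x 3 ^ 2 * w 5)
  | 3, 8 => -(z * Real.sinh (z * (x 0 - x 1)) * (w 0 - w 1) * x 6
      + Real.cosh (z * (x 0 - x 1)) * w 6)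
  | 4, 6 => -w 8
  | 4, 7 => z * Real.sinh (z * (x 0 - x 1)) * (w 0 - w 1) * x 5
      + Real.cosh (z * (x 0 - x 1)) * w 5
  | 4, 8 => -(z ^ 2 * (2 * x 4 * w 4 * x 6 + x 4 ^ 2 * w 6))
  | 5, 6 => Real.cosh (z * (x 1 - x 2)) * (w 1 - w 2)
  | 5, 7 => -(z ^ 2 * (2 * x 5 * w 5 * x 3 + x 5 ^ 2 * w 3))
  | 5, 8 => z * Real.sinh (z * (x 1 - x 2)) * (w 1 - w 2) * x 4
      + Real.cosh (z * (x 1 - x 2)) * w 4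
  | 6, 7 => -(z * Real.sinh (z * (x 1 - x 2)) * (w 1 - w 2) * x 3
      + Real.cosh (z * (x 1 - x 2)) * w 3)
  | 6, 8 => z ^ 2 * (2 * x 6 * w 6 * x 4 + x 6 ^ 2 * w 4)
  | 7, 8 => Real.cosh (z * (x 0 - x 2)) * (w 0 - w 2)
      + z * (z * Real.cosh (z * (x 0 - x 1)) * (w 0 - w 1) * x 5 * x 6
        + Real.sinh (z * (x 0 - x 1)) * (w 5 * x 6 + x 5 * w 6))
      + z * (z * Real.cosh (z * (x 1 - x 2)) * (w 1 - w 2) * x 3 * x 4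
        + Real.sinh (z * (x 1 - x 2)) * (w 3 * x 4 + x 3 * w 4))
  | _, _ => 0

theorem contDiff_piU (z : ℝ) (u v : ℕ) : ContDiff ℝ (⊤ : ℕ∞) (piU z u v) := by
  unfold piU
  split <;> fun_prop

theorem fderiv_piU {z : ℝ} (hz : z ≠ 0) (u v : ℕ) (x w : Fin 9 → ℝ) :
    fderiv ℝ (piU z u v) x w = piUDeriv z u v x w := by
  have happ (i : Fin 9) : fderiv ℝ (fun y : Fin 9 → ℝ => y i) x w = w i := by
    rw [(hasFDerivAt_apply i x).fderiv]
    rfl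
  unfold piU piUDeriv
  split <;>
    simp (disch := fun_prop) [happ, div_eq_mul_inv, fderiv_fun_add, fderiv_fun_sub, fderiv_fun_mul,
      fderiv_fun_pow, fderiv_sinh, fderiv_cosh]
  all_goals try field_simp
  all_goals try ring

set_option maxHeartbeats 4000000 in
theorem piMat_jacobi_of_lt {z : ℝ} (hz : z ≠ 0) (x : Fin 9 → ℝ) {i j k : Fin 9}
    (hij : i < j) (hjk : j < k) :
    fderiv ℝ (piMat z j k) x (fun l => piMat z i l x)
      + fderiv ℝ (piMat z k i) x (fun l => piMat z j l x)
      + fderiv ℝ (piMat z i j) x (fun l => piMat z k l x) = 0 := by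
  have hd (u v : Fin 9) (w) :
      fderiv ℝ (piMat z u v) x w = piUDeriv z u v x w - piUDeriv z v u x w := by
    have h (u v : Fin 9) : DifferentiableAt ℝ (piU z u v) x :=
      (contDiff_piU z u v).differentiable (by simp) x
    rw [← fderiv_piU hz, ← fderiv_piU hz]
    exact congrArg (· w) (fderiv_fun_sub (h u v) (h v u))
  have hsum : z * (x 0 - x 2) = z * (x 0 - x 1) + z * (x 1 - x 2) := by ring
  simp only [hd, piMat]
  clear hd
  fin_cases i <;> fin_cases j <;> first | (exfalso; revert hij; decide) | skip
  all_goals fin_cases k <;> first | (exfalso; revert hjk; decide) | skip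
  all_goals
    simp [piU, piUDeriv, hsum, Real.sinh_add, Real.cosh_add]
    try field_simp
    try ring

theorem piMat_swap (z : ℝ) (u v : Fin 9) (x : Fin 9 → ℝ) : piMat z u v x = -piMat z v u x := by
  simp [piMat]

theorem fderiv_piMat_swap (z : ℝ) (u v : Fin 9) (x : Fin 9 → ℝ) :
    fderiv ℝ (piMat z u v) x = -fderiv ℝ (piMat z v u) x := by
  rw [← fderiv_neg]
  exact congrArg (fderiv ℝ · x) (funext (piMat_swap z u v))

theorem piMat_jacobi {z : ℝ} (hz : z ≠ 0) (x : Fin 9 → ℝ) (i j k : Fin 9) :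
    fderiv ℝ (piMat z j k) x (fun l => piMat z i l x)
      + fderiv ℝ (piMat z k i) x (fun l => piMat z j l x)
      + fderiv ℝ (piMat z i j) x (fun l => piMat z k l x) = 0 := by
  have hself (u : Fin 9) : fderiv ℝ (piMat z u u) x = 0 := by
    rw [show piMat z u u = 0 from funext fun y => sub_self _, fderiv_zero]
    rfl
  have hsw (u v : Fin 9) (w) : fderiv ℝ (piMat z u v) x w = -fderiv ℝ (piMat z v u) x w := by
    rw [fderiv_piMat_swap]
    rfl
  have hlt {a b c : Fin 9} (hab : a < b) (hbc : b < c) := piMat_jacobi_of_lt hz x hab hbc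
  rcases lt_trichotomy i j with hij | rfl | hij
  · rcases lt_trichotomy j k with hjk | rfl | hjk
    · exact hlt hij hjk
    · rw [hself, hsw j i]; simp
    · rcases lt_trichotomy i k with hik | rfl | hik
      · rw [hsw j k, hsw k i, hsw i j]; linarith [hlt hik hjk]
      · rw [hself, hsw j i]; simp
      · linarith [hlt hik hij]
  · rw [hself, hsw k i]; simp
  · rcases lt_trichotomy j k with hjk | rfl | hjk
    · rcases lt_trichotomy i k with hik | rfl | hik
      · rw [hsw j k, hsw k i, hsw i j]; linarith [hlt hij hik]
      · rw [hself, hsw j i]; simp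
      · linarith [hlt hjk hik]
    · rw [hself, hsw j i]; simp
    · rw [hsw j k, hsw k i, hsw i j]; linarith [hlt hjk hij]

theorem ContinuousLinearMap.apply_eq_sum_single (L : (Fin 9 → ℝ) →L[ℝ] ℝ) (w : Fin 9 → ℝ) :
    L w = ∑ l, w l * L (Pi.single l 1) := by
  conv_lhs => rw [pi_eq_sum_univ' w, map_sum]
  simp

theorem pd_piMat_jacobi {z : ℝ} (hz : z ≠ 0) (x : Fin 9 → ℝ) (i j k : Fin 9) :
    ∑ l, (piMat z i l x * pd l (piMat z j k) x + piMat z j l x * pd l (piMat z k i) x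
      + piMat z k l x * pd l (piMat z i j) x) = 0 := by
  rw [← piMat_jacobi hz x i j k, ContinuousLinearMap.apply_eq_sum_single,
    ContinuousLinearMap.apply_eq_sum_single (fderiv ℝ (piMat z k i) x),
    ContinuousLinearMap.apply_eq_sum_single (fderiv ℝ (piMat z i j) x),
    ← Finset.sum_add_distrib, ← Finset.sum_add_distrib]
  rfl

theorem piU_eq_zero_of_le (z : ℝ) {u v : ℕ} (h : v ≤ u) (x : Fin 9 → ℝ) : piU z u v x = 0 := by
  unfold piU
  split <;> first | rfl | omega

theorem suq3Bracket_eq_sum_piMat (z : ℝ) (f g : (Fin 9 → ℝ) → ℝ) (x : Fin 9 → ℝ) :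
    suq3Bracket z f g x = ∑ u, ∑ v, piMat z u v x * (pd u f x * pd v g x) := by
  have hU (u v : Fin 9) :
      (if u < v then piU z u.val v.val x * (pd u f x * pd v g x - pd v f x * pd u g x) else 0)
        = piU z u v x * (pd u f x * pd v g x) - piU z u v x * (pd v f x * pd u g x) := by
    split_ifs with h
    · ring
    · rw [piU_eq_zero_of_le z (not_lt.mp h)]
      ring
  simp only [suq3Bracket, hU, piMat, sub_mul, Finset.sum_sub_distrib]
  congr 1
  exact Finset.sum_comm

theorem contDiff_piMat (z : ℝ) (u v : Fin 9) : ContDiff ℝ (⊤ : ℕ∞) (piMat z u v) :=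
  (contDiff_piU z u v).sub (contDiff_piU z v u)

theorem ContDiff.pd {f : (Fin 9 → ℝ) → ℝ} (hf : ContDiff ℝ (⊤ : ℕ∞) f) (i : Fin 9) :
    ContDiff ℝ (⊤ : ℕ∞) (pd i f) :=
  (hf.fderiv_right (m := (⊤ : ℕ∞)) (by simp)).clm_apply contDiff_const

theorem pd_comm {f : (Fin 9 → ℝ) → ℝ} (hf : ContDiff ℝ (⊤ : ℕ∞) f) (i j : Fin 9)
    (x : Fin 9 → ℝ) : pd i (pd j f) x = pd j (pd i f) x := by
  have hd : DifferentiableAt ℝ (fderiv ℝ f) x :=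
    (hf.fderiv_right (m := (⊤ : ℕ∞)) (by simp)).differentiable (by simp) x
  have h (a b : Fin 9) :
      pd a (pd b f) x = fderiv ℝ (fderiv ℝ f) x (Pi.single a 1) (Pi.single b 1) := by
    change fderiv ℝ (fun y => fderiv ℝ f y (Pi.single b 1)) x (Pi.single a 1) = _
    rw [fderiv_clm_apply hd (by fun_prop)]
    simp
  rw [h, h]
  exact hf.contDiffAt.isSymmSndFDerivAt (by simpa using WithTop.coe_le_coe.mpr (le_top (a := (2 : ℕ∞)))) _ _

theorem pd_suq3Bracket (z : ℝ) {g k : (Fin 9 → ℝ) → ℝ} (hg : ContDiff ℝ (⊤ : ℕ∞) g)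
    (hk : ContDiff ℝ (⊤ : ℕ∞) k) (l : Fin 9) (x : Fin 9 → ℝ) :
    pd l (suq3Bracket z g k) x = ∑ a, ∑ b, (pd l (piMat z a b) x * (pd a g x * pd b k x)
      + piMat z a b x * (pd l (pd a g) x * pd b k x + pd a g x * pd l (pd b k) x)) := by
  have hP (a b) : DifferentiableAt ℝ (piMat z a b) x :=
    (contDiff_piMat z a b).differentiable (by simp) x
  have hG (a) : DifferentiableAt ℝ (pd a g) x := (hg.pd a).differentiable (by simp) x
  have hK (b) : DifferentiableAt ℝ (pd b k) x := (hk.pd b).differentiable (by simp) x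
  have hterm (a b : Fin 9) :=
    (hP a b).hasFDerivAt.fun_mul ((hG a).hasFDerivAt.fun_mul (hK b).hasFDerivAt)
  have hsum := HasFDerivAt.fun_sum (u := Finset.univ) fun a _ =>
    HasFDerivAt.fun_sum (u := Finset.univ) fun b _ => hterm a b
  rw [pd, funext (suq3Bracket_eq_sum_piMat z g k), hsum.fderiv]
  simp only [_root_.sum_apply, _root_.add_apply,
    _root_.smul_apply, smul_eq_mul, pd]
  refine Finset.sum_congr rfl fun a _ => Finset.sum_congr rfl fun b _ => ?_
  ring

/-- The contribution of second derivatives to an iterated bracket. -/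
theorem sum_hessian_comm {ι : Type*} [Fintype ι] (P H : ι → ι → ℝ) (f g : ι → ℝ)
    (hH : ∀ i j, H i j = H j i) :
    ∑ u, ∑ v, P u v * (f u * ∑ a, ∑ b, P a b * (g a * H v b))
      = ∑ u, ∑ v, P u v * (g u * ∑ a, ∑ b, P a b * (f a * H v b)) := by
  simp only [Finset.mul_sum]
  calc _ = ∑ p : (ι × ι) × (ι × ι),
        P p.1.1 p.1.2 * (f p.1.1 * (P p.2.1 p.2.2 * (g p.2.1 * H p.1.2 p.2.2))) := by
        simp only [Fintype.sum_prod_type]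
    _ = ∑ p : (ι × ι) × (ι × ι),
        P p.1.1 p.1.2 * (g p.1.1 * (P p.2.1 p.2.2 * (f p.2.1 * H p.1.2 p.2.2))) := by
        refine Fintype.sum_equiv (Equiv.prodComm _ _) _ _ fun p => ?_
        simp only [Equiv.prodComm_apply, Prod.fst_swap, Prod.snd_swap]
        rw [hH]
        ring
    _ = _ := by simp only [Fintype.sum_prod_type]

/-- The pointwise algebra of the Jacobi identity: `P` is a bivector with first derivatives `dP`
and vanishing Schouten square, and `f`, `g`, `k` are gradients with Hessians `F`, `G`, `K`. -/
theorem jacobi_of_schouten_eq_zero {ι : Type*} [Fintype ι] (P : ι → ι → ℝ) (dP : ι → ι → ι → ℝ)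
    (f g k : ι → ℝ) (F G K : ι → ι → ℝ) (hP : ∀ i j, P i j = -P j i)
    (hJ : ∀ i j k, ∑ l, (P i l * dP l j k + P j l * dP l k i + P k l * dP l i j) = 0)
    (hF : ∀ i j, F i j = F j i) (hG : ∀ i j, G i j = G j i) (hK : ∀ i j, K i j = K j i) :
    (∑ u, ∑ v, P u v * (f u * ∑ a, ∑ b,
        (dP v a b * (g a * k b) + P a b * (G v a * k b + g a * K v b))))
      + (∑ u, ∑ v, P u v * (g u * ∑ a, ∑ b,
        (dP v a b * (k a * f b) + P a b * (K v a * f b + k a * F v b))))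
      + (∑ u, ∑ v, P u v * (k u * ∑ a, ∑ b,
        (dP v a b * (f a * g b) + P a b * (F v a * g b + f a * G v b)))) = 0 := by
  have hsplit (p q r : ι → ℝ) (Q R : ι → ι → ℝ) :
      (∑ u, ∑ v, P u v * (p u * ∑ a, ∑ b,
        (dP v a b * (q a * r b) + P a b * (Q v a * r b + q a * R v b))))
      = (∑ u, ∑ v, P u v * (p u * ∑ a, ∑ b, dP v a b * (q a * r b)))
        - (∑ u, ∑ v, P u v * (p u * ∑ a, ∑ b, P a b * (r a * Q v b)))
        + ∑ u, ∑ v, P u v * (p u * ∑ a, ∑ b, P a b * (q a * R v b)) := by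
    have hswap (v : ι) : ∑ a, ∑ b, P a b * (Q v a * r b) = -∑ a, ∑ b, P a b * (r a * Q v b) := by
      rw [Finset.sum_comm, ← Finset.sum_neg_distrib]
      refine Finset.sum_congr rfl fun a _ => ?_
      rw [← Finset.sum_neg_distrib]
      refine Finset.sum_congr rfl fun b _ => ?_
      rw [hP b a]
      ring
    simp only [mul_add (P _ _) (_ * _) (_ * _), Finset.sum_add_distrib, hswap]
    simp only [mul_add, mul_neg, Finset.sum_add_distrib, Finset.sum_neg_distrib]
    ring
  have hnormal (p q r : ι → ℝ) :
      ∑ u, ∑ v, P u v * (p u * ∑ a, ∑ b, dP v a b * (q a * r b))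
        = ∑ u, ∑ a, ∑ b, p u * q a * r b * ∑ v, P u v * dP v a b := by
    refine Finset.sum_congr rfl fun u _ => ?_
    simp only [Finset.mul_sum]
    rw [Finset.sum_comm]
    refine Finset.sum_congr rfl fun a _ => ?_
    rw [Finset.sum_comm]
    refine Finset.sum_congr rfl fun b _ => Finset.sum_congr rfl fun v _ => ?_
    ring
  have hcyc (φ : ι → ι → ι → ℝ) : ∑ u, ∑ a, ∑ b, φ u a b = ∑ u, ∑ a, ∑ b, φ a b u := by
    rw [Finset.sum_comm (f := fun u a => ∑ b, φ a b u)]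
    exact Finset.sum_congr rfl fun a _ => Finset.sum_comm
  have hfirst :
      (∑ u, ∑ v, P u v * (f u * ∑ a, ∑ b, dP v a b * (g a * k b)))
        + (∑ u, ∑ v, P u v * (g u * ∑ a, ∑ b, dP v a b * (k a * f b)))
        + (∑ u, ∑ v, P u v * (k u * ∑ a, ∑ b, dP v a b * (f a * g b))) = 0 := by
    rw [hnormal, hnormal, hnormal, hcyc fun u a b => g u * k a * f b * ∑ v, P u v * dP v a b,
      ← hcyc fun u a b => k b * f u * g a * ∑ v, P b v * dP v u a]
    simp only [← Finset.sum_add_distrib]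
    refine Finset.sum_eq_zero fun u _ => Finset.sum_eq_zero fun a _ =>
      Finset.sum_eq_zero fun b _ => ?_
    have h := hJ u a b
    simp only [Finset.sum_add_distrib] at h
    linear_combination f u * g a * k b * h
  rw [hsplit, hsplit, hsplit, sum_hessian_comm P K f g hK, sum_hessian_comm P G f k hG,
    sum_hessian_comm P F g k hF]
  linarith

/-- the su_q^P(3) bracket satisfies the Jacobi identity. -/
theorem suq3_jacobi (z : ℝ) (hz : z ≠ 0)
    (f g k : (Fin 9 → ℝ) → ℝ)
    (hf : ContDiff ℝ (⊤ : ℕ∞) f) (hg : ContDiff ℝ (⊤ : ℕ∞) g) (hk : ContDiff ℝ (⊤ : ℕ∞) k) :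
    ∀ x : Fin 9 → ℝ,
      suq3Bracket z f (suq3Bracket z g k) x
      + suq3Bracket z g (suq3Bracket z k f) x
      + suq3Bracket z k (suq3Bracket z f g) x = 0 := by
  intro x
  simp only [suq3Bracket_eq_sum_piMat z _ (suq3Bracket _ _ _), pd_suq3Bracket z hg hk,
    pd_suq3Bracket z hk hf, pd_suq3Bracket z hf hg]
  exact jacobi_of_schouten_eq_zero (fun i j => piMat z i j x) (fun l i j => pd l (piMat z i j) x)
    (fun i => pd i f x) (fun i => pd i g x) (fun i => pd i k x)
    (fun i j => pd i (pd j f) x) (fun i j => pd i (pd j g) x) (fun i j => pd i (pd j k) x)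
    (fun i j => piMat_swap z i j x) (fun i j k => pd_piMat_jacobi hz x i j k)
    (fun i j => pd_comm hf i j x) (fun i j => pd_comm hg i j x) (fun i j => pd_comm hk i j x)
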